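/- Let M ≥ 1 and let θ be a real number such that for some constant c' > 0, |θ − p/q| > c' / (q² (log q)^{2M}) for all integers p and positive integers q (with log q = max{1, log₂ q}). Then there is a constant C > 0 such that for all N ≥ 2 the discrepancy of the sequence of fractional parts ({nθ})_{n≥1} satisfies D_N({nθ}) ≤ C (log N)^{2M+1}. -/

import Mathlib

noncomputable section

/-- `plog q = max {1, log₂ q}`. -/
def plog (q : ℕ) : ℝ := max 1 (Real.logb 2 q)

/-- The counting function of the sequence `({nθ})_{n ≥ 1}`: the number of
`1 ≤ n ≤ N` with fractional part `{nθ} ∈ [0, x)`. -/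
def fractCount (θ : ℝ) (N : ℕ) (x : ℝ) : ℕ :=
  {n : ℕ | 1 ≤ n ∧ n ≤ N ∧ Int.fract ((n : ℝ) * θ) < x}.ncard

open Finset in
/-- An affine map `n ↦ k + n p` with `p` coprime to `q` permutes the residues modulo `q`. -/
theorem sum_range_emod_of_coprime (k p : ℤ) (q : ℕ) (hq : 0 < q) (hpq : IsCoprime p (q : ℤ)) :
    ∑ n ∈ range q, (k + n * p) % (q : ℤ) = ∑ n ∈ range q, (n : ℤ) := by
  have hq' : (q : ℤ) ≠ 0 := by exact_mod_cast hq.ne'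
  have hlt (n : ℕ) : ((k + n * p) % (q : ℤ)).toNat < q := by
    have h1 := Int.emod_nonneg (k + n * p) hq'
    have h2 := Int.emod_lt_of_pos (k + n * p) (by exact_mod_cast hq : (0 : ℤ) < q)
    omega
  have hinj : Set.InjOn (fun n : ℕ => ((k + n * p) % (q : ℤ)).toNat) (range q) := by
    intro a ha b hb hab
    simp only [coe_range, Set.mem_Iio] at ha hb
    have h1 := Int.emod_nonneg (k + a * p) hq'
    have h2 := Int.emod_nonneg (k + b * p) hq'
    have h3 : (k + a * p) % (q : ℤ) = (k + b * p) % (q : ℤ) := by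
      simp only at hab
      omega
    have h4 : (q : ℤ) ∣ (b - a : ℤ) * p := by
      have := Int.ModEq.dvd h3
      convert this using 1
      ring
    have h5 : (q : ℤ) ∣ (b - a : ℤ) := hpq.symm.dvd_of_dvd_mul_right h4
    have h6 : (b - a : ℤ) = 0 := by
      apply Int.eq_zero_of_abs_lt_dvd h5
      rw [abs_lt]
      constructor <;> omega
    omega
  have himg : (range q).image (fun n : ℕ => ((k + n * p) % (q : ℤ)).toNat) = range q := by
    apply eq_of_subset_of_card_le
    · intro m hm
      obtain ⟨n, -, rfl⟩ := mem_image.1 hm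
      exact mem_range.2 (hlt n)
    · rw [card_image_of_injOn hinj]
  conv_rhs => rw [← himg, sum_image hinj]
  refine sum_congr rfl fun n _ => ?_
  exact (Int.toNat_of_nonneg (Int.emod_nonneg _ hq')).symm

open Finset in
/-- A generalisation of Hermite's identity to an arithmetic progression of rational step. -/
theorem sum_fract_add_mul_div (γ : ℝ) (p : ℤ) (q : ℕ) (hq : 0 < q)
    (hpq : IsCoprime p (q : ℤ)) :
    ∑ n ∈ range q, Int.fract (γ + n * (p / q : ℝ)) = (q - 1) / 2 + Int.fract (q * γ) := by
  have hq0 : (0 : ℝ) < q := by exact_mod_cast hq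
  have hterm (n : ℕ) : Int.fract (γ + n * (p / q : ℝ)) =
      (((⌊q * γ⌋ + n * p) % (q : ℤ) : ℤ) : ℝ) / q + Int.fract (q * γ) / q := by
    have hfloor : ⌊γ + n * (p / q : ℝ)⌋ = (⌊q * γ⌋ + n * p) / (q : ℤ) := by
      have h : γ + n * (p / q : ℝ) = (q * γ + ((n * p : ℤ) : ℝ)) / q := by
        push_cast
        field_simp
      rw [h, Int.floor_div_natCast, Int.floor_add_intCast]
    have hdiv : (((⌊q * γ⌋ + n * p) % (q : ℤ) : ℤ) : ℝ) =
        ⌊q * γ⌋ + n * p - q * (((⌊q * γ⌋ + n * p) / (q : ℤ) : ℤ) : ℝ) := by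
      rw [Int.emod_def]
      push_cast
      ring
    rw [hdiv, Int.fract, hfloor, Int.fract]
    field_simp
    ring
  have hsum : (∑ n ∈ range q, (n : ℝ)) * 2 = q * (q - 1) := by
    have := Finset.sum_range_id_mul_two q
    have h := congrArg (Nat.cast : ℕ → ℝ) this
    push_cast [Nat.cast_sub (show 1 ≤ q from hq)] at h
    exact h
  have hperm := congrArg (Int.cast : ℤ → ℝ)
    (sum_range_emod_of_coprime ⌊q * γ⌋ p q hq hpq)
  rw [Int.cast_sum, Int.cast_sum] at hperm
  simp only [Int.cast_natCast] at hperm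
  simp_rw [hterm]
  rw [sum_add_distrib, ← sum_div, hperm, sum_const, card_range, nsmul_eq_mul]
  field_simp
  linarith

/-- The sum of the sawtooth function along the orbit of `β` under rotation by `θ`. -/
def sawtoothSum (θ : ℝ) (N : ℕ) (β : ℝ) : ℝ :=
  ∑ n ∈ Finset.range N, (Int.fract (β + n * θ) - 1 / 2)

theorem sawtoothSum_add (θ : ℝ) (a b : ℕ) (β : ℝ) :
    sawtoothSum θ (a + b) β = sawtoothSum θ a β + sawtoothSum θ b (β + a * θ) := by
  unfold sawtoothSum
  rw [Finset.sum_range_add]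
  congr 1
  refine Finset.sum_congr rfl fun n _ => ?_
  push_cast
  ring_nf

open Finset in
theorem abs_sawtoothSum_le_of_approx (θ : ℝ) (p : ℤ) (q : ℕ) (hq : 0 < q)
    (hpq : IsCoprime p (q : ℤ)) (happrox : |θ - p / q| ≤ 1 / (q * q : ℝ)) (β : ℝ) :
    |sawtoothSum θ q β| ≤ 5 / 2 := by
  have hq0 : (0 : ℝ) < q := by exact_mod_cast hq
  have hclose (n : ℕ) (hn : n ∈ range q) : |n * θ - n * (p / q : ℝ)| ≤ 1 / q := by
    have hn' : (n : ℝ) ≤ q := by exact_mod_cast (mem_range.1 hn).le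
    rw [← mul_sub, abs_mul, Nat.abs_cast]
    calc (n : ℝ) * |θ - p / q| ≤ q * (1 / (q * q)) := by gcongr
      _ = 1 / q := by field_simp
  have hupper (n : ℕ) (hn : n ∈ range q) : Int.fract (β + n * θ) - 1 / 2 ≤
      Int.fract (β - 1 / q + n * (p / q : ℝ)) + 2 / q - 1 / 2 := by
    have h := abs_le.1 (hclose n hn)
    have hfl : (⌊β - 1 / q + n * (p / q : ℝ)⌋ : ℝ) ≤ ⌊β + n * θ⌋ := by
      exact Int.cast_le.2 (Int.floor_mono (by linarith))
    have : (2 : ℝ) / q = 1 / q + 1 / q := by ring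
    simp only [Int.fract]
    linarith
  have hlower (n : ℕ) (hn : n ∈ range q) :
      Int.fract (β + 1 / q + n * (p / q : ℝ)) - 2 / q - 1 / 2 ≤
      Int.fract (β + n * θ) - 1 / 2 := by
    have h := abs_le.1 (hclose n hn)
    have hfl : (⌊β + n * θ⌋ : ℝ) ≤ ⌊β + 1 / q + n * (p / q : ℝ)⌋ := by
      exact Int.cast_le.2 (Int.floor_mono (by linarith))
    have : (2 : ℝ) / q = 1 / q + 1 / q := by ring
    simp only [Int.fract]
    linarith
  have hU := sum_le_sum hupper
  have hL := sum_le_sum hlower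
  simp only [sum_sub_distrib, sum_add_distrib, sum_const, card_range, nsmul_eq_mul,
    sum_fract_add_mul_div _ p q hq hpq] at hU hL
  have h2 : (q : ℝ) * (2 / q) = 2 := by field_simp
  rw [h2] at hU hL
  have f1 := Int.fract_lt_one (q * (β - 1 / q : ℝ))
  have f2 := Int.fract_nonneg (q * (β + 1 / q : ℝ))
  simp only [sawtoothSum, sum_sub_distrib, sum_const, card_range, nsmul_eq_mul]
  rw [abs_le]
  constructor <;> linarith

theorem abs_sawtoothSum_mul_le (θ : ℝ) (q : ℕ) (B : ℝ) (hB : ∀ β, |sawtoothSum θ q β| ≤ B)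
    (k : ℕ) (β : ℝ) : |sawtoothSum θ (q * k) β| ≤ k * B := by
  induction k with
  | zero => simp [sawtoothSum]
  | succ k ih =>
    rw [mul_add_one, sawtoothSum_add]
    have h := abs_add_le (sawtoothSum θ (q * k) β) (sawtoothSum θ q (β + (q * k : ℕ) * θ))
    have h' := hB (β + (q * k : ℕ) * θ)
    push_cast at *
    linarith

theorem one_le_plog (q : ℕ) : 1 ≤ plog q := le_max_left _ _

theorem plog_mono {a b : ℕ} (ha : 0 < a) (hab : a ≤ b) : plog a ≤ plog b := by
  unfold plog
  gcongr
  norm_num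

/-- Dividing out the blocks of length a Dirichlet denominator `q ≤ N` leaves a remainder
`N % q < N / 2`, so each dyadic scale contributes at most `5 / 2 * A`. -/
theorem abs_sawtoothSum_le_of_lt_two_pow (θ A : ℝ) (hA₀ : 0 ≤ A) (N₀ : ℕ)
    (hA : ∀ (p : ℤ) (q N : ℕ), 0 < q → q ≤ N → N ≤ N₀ →
      |θ - p / q| ≤ 1 / ((N + 1) * q : ℝ) → (N / q : ℝ) ≤ A)
    (j N : ℕ) (hN : N < 2 ^ j) (hNN : N ≤ N₀) (β : ℝ) :
    |sawtoothSum θ N β| ≤ j * (5 / 2 * A) := by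
  induction j generalizing N β with
  | zero =>
    obtain rfl : N = 0 := by simpa using hN
    simp [sawtoothSum]
  | succ j ih =>
    rcases Nat.eq_zero_or_pos N with rfl | hpos
    · simp only [sawtoothSum, Finset.range_zero, Finset.sum_empty, abs_zero]
      positivity
    obtain ⟨r, hr, hden⟩ := Real.exists_rat_abs_sub_le_and_den_le θ hpos
    have hq : 0 < r.den := r.den_pos
    have hcop : IsCoprime r.num (r.den : ℤ) := Int.isCoprime_iff_gcd_eq_one.2 r.reduced
    rw [Rat.cast_def] at hr
    have hq0 : (0 : ℝ) < r.den := by exact_mod_cast hq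
    have hqN : (r.den : ℝ) ≤ N := by exact_mod_cast hden
    have hblock := abs_sawtoothSum_le_of_approx θ r.num r.den hq hcop
      (hr.trans (by gcongr; linarith))
    have hk : ((N / r.den : ℕ) : ℝ) ≤ A :=
      Nat.cast_div_le.trans (hA r.num r.den N hq hden hNN hr)
    have hmod : N % r.den < 2 ^ j := by
      have h1 := Nat.mod_lt N hq
      have h2 := Nat.div_add_mod N r.den
      have h3 : r.den * 1 ≤ r.den * (N / r.den) :=
        Nat.mul_le_mul_left _ (Nat.div_pos hden hq)
      rw [pow_succ] at hN
      omega
    have hrest := ih (N % r.den) hmod ((Nat.mod_le _ _).trans hNN)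
      (β + (r.den * (N / r.den) : ℕ) * θ)
    have hmain := abs_sawtoothSum_mul_le θ r.den _ hblock (N / r.den) β
    have hsplit := sawtoothSum_add θ (r.den * (N / r.den)) (N % r.den) β
    rw [Nat.div_add_mod] at hsplit
    rw [hsplit]
    refine (abs_add_le _ _).trans ?_
    push_cast at *
    linarith

open Finset in
theorem fractCount_sub_eq_sawtoothSum (θ : ℝ) (N : ℕ) (x : ℝ) (hx : x ∈ Set.Icc (0 : ℝ) 1) :
    (fractCount θ N x : ℝ) - N * x = sawtoothSum θ N (θ - x) - sawtoothSum θ N θ := by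
  have hset : {n : ℕ | 1 ≤ n ∧ n ≤ N ∧ Int.fract ((n : ℝ) * θ) < x} =
      (((range N).filter fun n : ℕ => Int.fract (θ + n * θ) < x).image (· + 1) : Finset ℕ) := by
    ext n
    simp only [Set.mem_ofPred_eq, coe_image, coe_filter, mem_range, Set.mem_image]
    constructor
    · rintro ⟨h1, h2, h3⟩
      refine ⟨n - 1, ⟨by omega, ?_⟩, by omega⟩
      convert h3 using 2
      push_cast [Nat.cast_sub h1]
      ring
    · rintro ⟨m, ⟨h1, h2⟩, rfl⟩
      refine ⟨by omega, by omega, ?_⟩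
      convert h2 using 2
      push_cast
      ring
  have hind (t : ℝ) : (if Int.fract t < x then (1 : ℝ) else 0) - x =
      (Int.fract (t - x) - 1 / 2) - (Int.fract t - 1 / 2) := by
    have h0 := Int.fract_nonneg t
    have h1 := Int.fract_lt_one t
    have ht := Int.floor_add_fract t
    split_ifs with h
    · have : Int.fract (t - x) = Int.fract t - x + 1 :=
        Int.fract_eq_iff.2 ⟨by linarith [hx.2], by linarith, ⌊t⌋ - 1, by push_cast; linarith⟩
      linarith
    · have : Int.fract (t - x) = Int.fract t - x :=
        Int.fract_eq_iff.2 ⟨by linarith, by linarith [hx.1], ⌊t⌋, by linarith⟩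
      linarith
  rw [fractCount, hset, Set.ncard_coe_finset, card_image_of_injective _ (add_left_injective 1),
    ← sum_boole, sawtoothSum, sawtoothSum, ← sum_sub_distrib]
  have hN : (N : ℝ) * x = ∑ _n ∈ range N, x := by simp
  rw [hN, ← sum_sub_distrib]
  refine sum_congr rfl fun n _ => ?_
  rw [hind, show θ + n * θ - x = θ - x + n * θ by ring]

theorem natLog_add_one_le_two_mul_plog (N : ℕ) : ((Nat.log 2 N + 1 : ℕ) : ℝ) ≤ 2 * plog N := by
  have h := Real.natLog_le_logb N 2
  have h1 : Real.logb 2 N ≤ plog N := le_max_right _ _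
  have h2 := one_le_plog N
  push_cast at *
  linarith

/-- If `|θ - p/q| > c'/(q² (log q)^{2M})` for all integers `p` and positive integers
`q`, then the discrepancy of `({nθ})` satisfies `D_N({nθ}) ≤ C (log N)^{2M+1}`. -/
theorem one_dim_discrepancy_lacunary_order_M_type
    (M : ℕ) (hM : 1 ≤ M) (θ : ℝ) (c' : ℝ) (hc' : 0 < c')
    (hθ : ∀ (p : ℤ) (q : ℕ), 0 < q →
      |θ - (p : ℝ) / (q : ℝ)| > c' / ((q : ℝ) ^ 2 * (plog q) ^ (2 * M))) :
    ∃ C : ℝ, 0 < C ∧ ∀ N : ℕ, 2 ≤ N → ∀ x ∈ Set.Icc (0:ℝ) 1,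
      |(fractCount θ N x : ℝ) - (N : ℝ) * x| ≤ C * (plog N) ^ (2 * M + 1) := by
  refine ⟨10 / c', by positivity, fun N hN x hx => ?_⟩
  have hP : 0 < plog N := zero_lt_one.trans_le (one_le_plog N)
  have hA (p : ℤ) (q K : ℕ) (hq : 0 < q) (hqK : q ≤ K) (hKN : K ≤ N)
      (happrox : |θ - p / q| ≤ 1 / ((K + 1) * q : ℝ)) :
      (K / q : ℝ) ≤ plog N ^ (2 * M) / c' := by
    have hq0 : (0 : ℝ) < q := by exact_mod_cast hq
    have hL : (1 : ℝ) ≤ plog q := one_le_plog q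
    have hmono : plog q ^ (2 * M) ≤ plog N ^ (2 * M) := by
      have := plog_mono hq (hqK.trans hKN)
      gcongr
    have hlow := (hθ p q hq).trans_le happrox
    have hP : 0 < plog q ^ (2 * M) := by positivity
    rw [div_lt_div_iff₀ (by positivity) (by positivity)] at hlow
    have h : c' * (K + 1) < q * plog q ^ (2 * M) := by
      refine lt_of_mul_lt_mul_right ?_ hq0.le
      linarith
    rw [div_le_div_iff₀ hq0 hc']
    have := mul_le_mul_of_nonneg_left hmono hq0.le
    linarith
  have hbound := abs_sawtoothSum_le_of_lt_two_pow θ _ (by positivity) N hA (Nat.log 2 N + 1) N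
    (Nat.lt_pow_succ_log_self one_lt_two N) le_rfl
  have hlog := mul_le_mul_of_nonneg_right (natLog_add_one_le_two_mul_plog N)
    (show 0 ≤ 5 / 2 * (plog N ^ (2 * M) / c') by positivity)
  have hC : 10 / c' * plog N ^ (2 * M + 1) =
      2 * (2 * plog N * (5 / 2 * (plog N ^ (2 * M) / c'))) := by
    rw [pow_succ]
    ring
  rw [fractCount_sub_eq_sawtoothSum θ N x hx, hC]
  refine (abs_sub _ _).trans ?_
  linarith [hbound (θ - x), hbound θ]

end
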